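/- Let S be a monoid and A a right S-act. The following are equivalent: (i) A is hollow and A has a maximal subact; (ii) A is cyclic and local; (iii) A is finitely generated and local; (iv) every proper subact of A is contained in a maximal subact of A, and A is local; (v) A has a maximal subact N which is superfluous in A; (vi) A has a subact N containing every proper subact of A (a maximum proper subact) which is superfluous in A. -/

import Mathlib

variable {S : Type*} [Monoid S] {A : Type*}

/-- A subact of a right `S`-act: a nonempty subset closed under the action. -/
def IsSubact (act : A → S → A) (B : Set A) : Prop :=
  B.Nonempty ∧ ∀ b ∈ B, ∀ s : S, act b s ∈ B

/-- `C` is superfluous in the whole act `A`: its union with any proper subact is proper. -/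
def Superfluous (act : A → S → A) (C : Set A) : Prop :=
  ∀ D : Set A, IsSubact act D → D ≠ Set.univ → C ∪ D ≠ Set.univ

/-- `C` is superfluous in the subact `B` (viewed as a right `S`-act in its own right). -/
def SuperfluousIn (act : A → S → A) (C B : Set A) : Prop :=
  ∀ D : Set A, IsSubact act D → D ⊆ B → D ≠ B → C ∪ D ≠ B

/-- `C` is coessential in `A`: for every proper subact `D` meeting `C`, `C ∪ D ≠ A`. -/
def Coessential (act : A → S → A) (C : Set A) : Prop :=
  ∀ D : Set A, IsSubact act D → D ≠ Set.univ → (C ∩ D).Nonempty → C ∪ D ≠ Set.univ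

/-- The act `A` is indecomposable: not a union of two disjoint subacts. -/
def IndecomposableAct (act : A → S → A) : Prop :=
  ¬ ∃ B C : Set A, IsSubact act B ∧ IsSubact act C ∧ B ∩ C = ∅ ∧ B ∪ C = Set.univ

/-- The subact `B` is indecomposable as an act in its own right. -/
def IndecompIn (act : A → S → A) (B : Set A) : Prop :=
  ¬ ∃ C D : Set A, IsSubact act C ∧ IsSubact act D ∧ C ⊆ B ∧ D ⊆ B ∧
      C ∩ D = ∅ ∧ C ∪ D = B

/-- The act `A` is simple: it has no proper subacts. -/
def SimpleAct (act : A → S → A) : Prop :=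
  ∀ B : Set A, IsSubact act B → B = Set.univ

/-- The subact `B` is simple as an act in its own right. -/
def SimpleIn (act : A → S → A) (B : Set A) : Prop :=
  ∀ C : Set A, IsSubact act C → C ⊆ B → C = B

/-- The act `A` is hollow: every proper subact is superfluous. -/
def Hollow (act : A → S → A) : Prop :=
  ∀ B : Set A, IsSubact act B → B ≠ Set.univ → Superfluous act B

/-- The subact `B` is hollow as an act in its own right. -/
def HollowIn (act : A → S → A) (B : Set A) : Prop :=
  ∀ C : Set A, IsSubact act C → C ⊆ B → C ≠ B → SuperfluousIn act C B

/-- The act `A` is co-uniform: every proper subact is coessential. -/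
def CoUniform (act : A → S → A) : Prop :=
  ∀ B : Set A, IsSubact act B → B ≠ Set.univ → Coessential act B

/-- The act `A` is cyclic: `A = aS` for some `a`. -/
def Cyclic (act : A → S → A) : Prop :=
  ∃ a : A, Set.range (act a) = Set.univ

/-- The act `A` is locally cyclic. -/
def LocallyCyclic (act : A → S → A) : Prop :=
  ∀ a a' : A, ∃ a'' : A, a ∈ Set.range (act a'') ∧ a' ∈ Set.range (act a'')

/-- The set `G` generates the act `A`. -/
def Generates (act : A → S → A) (G : Set A) : Prop :=
  (⋃ g ∈ G, Set.range (act g)) = Set.univ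

/-- The act `A` is finitely generated. -/
def FinGen (act : A → S → A) : Prop :=
  ∃ F : Finset A, (⋃ a ∈ F, Set.range (act a)) = Set.univ

/-- `M` is a maximal subact of `A`: a proper subact such that the only subact
strictly containing it is `A` itself. -/
def IsMaxSubact (act : A → S → A) (M : Set A) : Prop :=
  IsSubact act M ∧ M ≠ Set.univ ∧ ∀ C : Set A, IsSubact act C → M ⊂ C → C = Set.univ

/-- The act `A` is local: it has exactly one maximal subact. -/
def LocalAct (act : A → S → A) : Prop :=
  ∃! M : Set A, IsMaxSubact act M

/-- The radical of `A`: the intersection of all maximal subacts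
(`= A` when there is no maximal subact, since `⋂₀ ∅ = Set.univ`). -/
def RadAct (act : A → S → A) : Set A :=
  ⋂₀ {M : Set A | IsMaxSubact act M}

/-- `C` is a supplement of `B` in `A`. -/
def IsSupplement (act : A → S → A) (B C : Set A) : Prop :=
  IsSubact act C ∧ B ∪ C = Set.univ ∧
    ∀ D : Set A, IsSubact act D → D ⊆ C → B ∪ D = Set.univ → D = C

/-- The act `A` is supplemented: every proper subact has a supplement. -/
def Supplemented (act : A → S → A) : Prop :=
  ∀ B : Set A, IsSubact act B → B ≠ Set.univ → ∃ C : Set A, IsSupplement act B C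

theorem isSubact_range {act : A → S → A} (hone : ∀ a : A, act a 1 = a)
    (hmul : ∀ (a : A) (s t : S), act a (s * t) = act (act a s) t) (a : A) :
    IsSubact act (Set.range (act a)) := by
  refine ⟨⟨a, 1, hone a⟩, ?_⟩
  rintro _ ⟨s, rfl⟩ t
  exact ⟨s * t, hmul a s t⟩

theorem IsSubact.union {S A : Type*} {act : A → S → A} {B C : Set A}
    (hB : IsSubact act B) (hC : IsSubact act C) : IsSubact act (B ∪ C) := by
  refine ⟨hB.1.mono Set.subset_union_left, ?_⟩
  rintro b (hb | hb) s
  · exact Or.inl (hB.2 b hb s)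
  · exact Or.inr (hC.2 b hb s)

theorem isSubact_sUnion {S A : Type*} {act : A → S → A} {c : Set (Set A)}
    (hc : ∀ B ∈ c, IsSubact act B) (hne : c.Nonempty) : IsSubact act (⋃₀ c) := by
  obtain ⟨B, hB⟩ := hne
  refine ⟨(hc B hB).1.mono (Set.subset_sUnion_of_mem hB), ?_⟩
  rintro b ⟨C, hC, hb⟩ s
  exact ⟨C, hC, (hc C hC).2 b hb s⟩

/-- A superfluous maximal subact contains every proper subact. -/
theorem IsMaxSubact.subset_of_superfluous {S A : Type*} {act : A → S → A} {N D : Set A}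
    (hN : IsMaxSubact act N) (hs : Superfluous act N) (hD : IsSubact act D)
    (hne : D ≠ Set.univ) : D ⊆ N := by
  by_contra h
  refine hs D hD hne (hN.2.2 _ (hN.1.union hD) ⟨Set.subset_union_left, fun h' => h ?_⟩)
  exact Set.subset_union_right.trans h'

theorem superfluous_of_forall_subset {S A : Type*} {act : A → S → A} {B N : Set A}
    (hN : N ≠ Set.univ) (h : ∀ D : Set A, IsSubact act D → D ≠ Set.univ → D ⊆ N)
    (hB : B ⊆ N) : Superfluous act B := fun D hD hne hu =>
  hN (Set.univ_subset_iff.1 (hu ▸ Set.union_subset hB (h D hD hne)))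

theorem IsMaxSubact.localAct_of_superfluous {S A : Type*} {act : A → S → A} {N : Set A}
    (hN : IsMaxSubact act N) (hs : Superfluous act N) : LocalAct act := by
  refine ⟨N, hN, fun M hM => ?_⟩
  by_contra hne
  exact hN.2.1 (hM.2.2 N hN.1
    ((hN.subset_of_superfluous hs hM.1 hM.2.1).ssubset_of_ne hne))

theorem IsMaxSubact.cyclic_of_superfluous {act : A → S → A} (hone : ∀ a : A, act a 1 = a)
    (hmul : ∀ (a : A) (s t : S), act a (s * t) = act (act a s) t) {N : Set A}
    (hN : IsMaxSubact act N) (hs : Superfluous act N) : Cyclic act := by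
  obtain ⟨a, ha⟩ := (Set.ne_univ_iff_exists_notMem N).1 hN.2.1
  refine ⟨a, ?_⟩
  by_contra hne
  exact ha (hN.subset_of_superfluous hs (isSubact_range hone hmul a) hne ⟨1, hone a⟩)

theorem Cyclic.finGen {S A : Type*} {act : A → S → A} (h : Cyclic act) : FinGen act := by
  obtain ⟨a, ha⟩ := h
  exact ⟨{a}, by simpa using ha⟩

/-- In a finitely generated act every proper subact is contained in a maximal one. -/
theorem FinGen.exists_isMaxSubact {S A : Type*} {act : A → S → A} (hfg : FinGen act)
    {B : Set A} (hB : IsSubact act B) (hne : B ≠ Set.univ) :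
    ∃ M : Set A, IsMaxSubact act M ∧ B ⊆ M := by
  obtain ⟨F, hF⟩ := hfg
  have eq_univ : ∀ C : Set A, IsSubact act C → (F : Set A) ⊆ C → C = Set.univ := by
    intro C hC hFC
    rw [← Set.univ_subset_iff, ← hF]
    refine Set.iUnion₂_subset fun a ha => ?_
    rintro _ ⟨s, rfl⟩
    exact hC.2 a (hFC ha) s
  obtain ⟨M, hBM, hM⟩ := zorn_subset_nonempty {C : Set A | IsSubact act C ∧ C ≠ Set.univ}
    (fun c hc hchain hcne => by
      refine ⟨⋃₀ c, ⟨isSubact_sUnion (fun C hC => (hc hC).1) hcne, fun hu => ?_⟩,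
        fun C hC => Set.subset_sUnion_of_mem hC⟩
      obtain ⟨C, hC, hFC⟩ := hchain.directedOn.exists_mem_subset_of_finite_of_subset_sUnion
        hcne F.finite_toSet (hu ▸ Set.subset_univ _)
      exact (hc hC).2 (eq_univ C (hc hC).1 hFC)) B ⟨hB, hne⟩
  refine ⟨M, ⟨hM.prop.1, hM.prop.2, fun C hC hMC => ?_⟩, hBM⟩
  by_contra hCne
  exact hMC.2 (hM.le_of_ge ⟨hC, hCne⟩ hMC.1)

/-- characterizations of hollow acts with a maximal subact. -/
theorem hollow_local_tfae
    (act : A → S → A) [Nonempty A]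
    (hone : ∀ a : A, act a 1 = a)
    (hmul : ∀ (a : A) (s t : S), act a (s * t) = act (act a s) t) :
    List.TFAE
      [Hollow act ∧ ∃ M : Set A, IsMaxSubact act M,
       Cyclic act ∧ LocalAct act,
       FinGen act ∧ LocalAct act,
       (∀ B : Set A, IsSubact act B → B ≠ Set.univ →
          ∃ M : Set A, IsMaxSubact act M ∧ B ⊆ M) ∧ LocalAct act,
       ∃ N : Set A, IsMaxSubact act N ∧ Superfluous act N,
       ∃ N : Set A, IsSubact act N ∧ N ≠ Set.univ ∧
          (∀ B : Set A, IsSubact act B → B ≠ Set.univ → B ⊆ N) ∧ Superfluous act N] := by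
  tfae_have 1 → 2 := fun ⟨hh, M, hM⟩ =>
    have hs := hh M hM.1 hM.2.1
    ⟨hM.cyclic_of_superfluous hone hmul hs, hM.localAct_of_superfluous hs⟩
  tfae_have 2 → 3 := fun ⟨hc, hl⟩ => ⟨hc.finGen, hl⟩
  tfae_have 3 → 4 := fun ⟨hfg, hl⟩ => ⟨fun _ hB hne => hfg.exists_isMaxSubact hB hne, hl⟩
  tfae_have 4 → 6 := by
    rintro ⟨hmax, N, hN, huniq⟩
    have hsub : ∀ D : Set A, IsSubact act D → D ≠ Set.univ → D ⊆ N := by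
      intro D hD hne
      obtain ⟨M, hM, hDM⟩ := hmax D hD hne
      exact huniq M hM ▸ hDM
    exact ⟨N, hN.1, hN.2.1, hsub, superfluous_of_forall_subset hN.2.1 hsub subset_rfl⟩
  tfae_have 6 → 5 := by
    rintro ⟨N, hN, hne, hsub, hs⟩
    refine ⟨N, ⟨hN, hne, fun C hC hNC => ?_⟩, hs⟩
    by_contra hCne
    exact hNC.2 (hsub C hC hCne)
  tfae_have 5 → 1 := by
    rintro ⟨N, hN, hs⟩
    have hsub := fun D => hN.subset_of_superfluous (D := D) hs
    exact ⟨fun B hB hne => superfluous_of_forall_subset hN.2.1 hsub (hsub B hB hne), N, hN⟩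
  tfae_finish
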